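/- For every real z with 0 < z < 1, the first-occurrence generating function has the closed form F(z) = ( 1 + (1−z) · ( Σ_{ℓ ∈ S⊡S} P_{s_{ℓ+1}⋯s_k} · z^{k−ℓ} ) / ( P_S · z^k ) )^{−1}. -/

import Mathlib

open MeasureTheory ENNReal

def occursAt (S : List Bool) (ω : ℕ → Bool) (n : ℕ) : Prop :=
  S.length ≤ n ∧ ∀ j < S.length, ω (n - S.length + j) = S.getD j false

noncomputable def firstOcc (S : List Bool) (ω : ℕ → Bool) : ℕ∞ :=
  ⨅ (n : ℕ) (_ : occursAt S ω n), (n : ℕ∞)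

noncomputable def f (μ : Measure (ℕ → Bool)) (S : List Bool) (n : ℕ) : ℝ≥0∞ :=
  μ {ω | firstOcc S ω = (n : ℕ∞)}

/-- The probability generating function `F(z) = ∑ f_n zⁿ`. -/
noncomputable def F (μ : Measure (ℕ → Bool)) (S : List Bool) (z : ℝ) : ℝ :=
  ∑' n : ℕ, (f μ S n).toReal * z ^ n

/-- `P_W = p^{#H} q^{#T}`, the probability of generating the string `W`. -/
def strProb (p : ℝ) (W : List Bool) : ℝ :=
  p ^ W.count true * (1 - p) ^ W.count false

/-- The overlap set `S ⊡ W`. -/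
def overlaps (S W : List Bool) : Finset ℕ :=
  (Finset.Icc 1 (min S.length W.length)).filter fun i => S.drop (S.length - i) = W.take i

theorem prod_range_getD_eq_strProb {p : ℝ} (hp0 : 0 < p) (hp1 : p < 1) (W : List Bool) :
    ∏ i ∈ Finset.range W.length,
        (if W.getD i false then ENNReal.ofReal p else ENNReal.ofReal (1 - p))
      = ENNReal.ofReal (strProb p W) := by
  have hq : 0 ≤ 1 - p := by linarith
  induction W with
  | nil => simp [strProb]
  | cons c W ih =>
    rw [List.length_cons, Finset.prod_range_succ']
    simp only [List.getD_cons_succ, List.getD_cons_zero, ih]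
    cases c
    · simp only [strProb, List.count_cons_self, Bool.false_eq_true, if_false]
      rw [← ENNReal.ofReal_mul (by positivity), List.count_cons_of_ne (by simp)]
      congr 1
      ring
    · simp only [strProb, List.count_cons_self, if_true]
      rw [← ENNReal.ofReal_mul (by positivity), List.count_cons_of_ne (by simp)]
      congr 1
      ring

theorem measurableSet_preimage_restrict (n : ℕ) (s : Set (Fin n → Bool)) :
    MeasurableSet ((fun (ω : ℕ → Bool) (i : Fin n) => ω i) ⁻¹' s) := by
  have h : Measurable fun (ω : ℕ → Bool) (i : Fin n) => ω i :=
    measurable_pi_lambda _ fun i => measurable_pi_apply (i : ℕ)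
  exact h s.toFinite.measurableSet

theorem eq_preimage_restrict {n : ℕ} {E : Set (ℕ → Bool)}
    (hE : ∀ ω ω' : ℕ → Bool, (∀ i < n, ω i = ω' i) → ω ∈ E → ω' ∈ E) :
    E = (fun (ω : ℕ → Bool) (i : Fin n) => ω i) ⁻¹'
      ((fun (ω : ℕ → Bool) (i : Fin n) => ω i) '' E) := by
  refine Set.Subset.antisymm (Set.subset_preimage_image _ _) ?_
  rintro ω ⟨ω', hω', h⟩
  exact hE ω' ω (fun i hi => congrFun h ⟨i, hi⟩) hω'

theorem measurableSet_of_dependsOn {n : ℕ} {E : Set (ℕ → Bool)}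
    (hE : ∀ ω ω' : ℕ → Bool, (∀ i < n, ω i = ω' i) → ω ∈ E → ω' ∈ E) : MeasurableSet E := by
  rw [eq_preimage_restrict hE]
  exact measurableSet_preimage_restrict n _

/-- The event that the word `W` is read at the coordinates `n, n + 1, …`. -/
def readsAt (W : List Bool) (n : ℕ) : Set (ℕ → Bool) :=
  {ω | ∀ j < W.length, ω (n + j) = W.getD j false}

theorem measurableSet_readsAt (W : List Bool) (n : ℕ) : MeasurableSet (readsAt W n) := by
  refine measurableSet_of_dependsOn (n := n + W.length) fun ω ω' h hω j hj => ?_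
  rw [← h _ (by omega)]
  exact hω j hj

/-- An event determined by the first `n` coordinates is independent of the word read
from coordinate `n` on. -/
theorem measure_inter_readsAt {p : ℝ} (hp0 : 0 < p) (hp1 : p < 1) (μ : Measure (ℕ → Bool))
    (hμ : ∀ (n : ℕ) (b : ℕ → Bool),
      μ {ω | ∀ i < n, ω i = b i}
        = ∏ i ∈ Finset.range n, (if b i then ENNReal.ofReal p else ENNReal.ofReal (1 - p)))
    {n : ℕ} {E : Set (ℕ → Bool)}
    (hE : ∀ ω ω' : ℕ → Bool, (∀ i < n, ω i = ω' i) → ω ∈ E → ω' ∈ E) (W : List Bool) :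
    μ (E ∩ readsAt W n) = μ E * ENNReal.ofReal (strProb p W) := by
  classical
  set r : (ℕ → Bool) → Fin n → Bool := fun ω i => ω i with hr
  obtain ⟨s, hs⟩ : ∃ s : Finset (Fin n → Bool), E = r ⁻¹' (s : Set (Fin n → Bool)) :=
    ⟨(r '' E).toFinite.toFinset, by simpa using eq_preimage_restrict hE⟩
  have hmeas : ∀ y ∈ s, MeasurableSet (r ⁻¹' {y}) :=
    fun y _ => measurableSet_preimage_restrict n _
  rw [hs, ← Measure.restrict_apply (measurableSet_preimage_restrict n _),
    ← sum_measure_preimage_singleton s hmeas, ← sum_measure_preimage_singleton s hmeas,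
    Finset.sum_mul]
  refine Finset.sum_congr rfl fun y hy => ?_
  rw [Measure.restrict_apply (hmeas y hy)]
  let b : ℕ → Bool := fun i => if h : i < n then y ⟨i, h⟩ else W.getD (i - n) false
  have hb : ∀ j, b (n + j) = W.getD j false := fun j => by simp [b]
  have h1 : r ⁻¹' {y} = {ω | ∀ i < n, ω i = b i} := by
    ext ω
    simp only [Set.mem_preimage, Set.mem_singleton_iff, Set.mem_ofPred_eq, funext_iff, hr]
    constructor
    · intro h i hi
      simpa [b, hi] using h ⟨i, hi⟩
    · intro h i
      simpa [b] using h i i.2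
  have h2 : r ⁻¹' {y} ∩ readsAt W n = {ω | ∀ i < n + W.length, ω i = b i} := by
    rw [h1]
    ext ω
    simp only [readsAt, Set.mem_inter_iff, Set.mem_ofPred_eq]
    constructor
    · rintro ⟨h, h'⟩ i hi
      rcases lt_or_ge i n with hin | hin
      · exact h i hin
      · obtain ⟨j, rfl⟩ := Nat.exists_eq_add_of_le hin
        rw [hb]
        exact h' j (by omega)
    · intro h
      refine ⟨fun i hi => h i (by omega), fun j hj => ?_⟩
      rw [← hb]
      exact h _ (by omega)
  rw [h2, h1, hμ, hμ, Finset.prod_range_add, ← prod_range_getD_eq_strProb hp0 hp1 W]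
  simp only [hb]

theorem occursAt_congr {S : List Bool} {ω ω' : ℕ → Bool} {m n : ℕ} (hmn : m ≤ n)
    (h : ∀ i < n, ω i = ω' i) : occursAt S ω m ↔ occursAt S ω' m := by
  refine and_congr_right fun hm => forall₂_congr fun j hj => ?_
  rw [h _ (by omega)]

theorem firstOcc_eq_iff {S : List Bool} {ω : ℕ → Bool} {n : ℕ} :
    firstOcc S ω = n ↔ occursAt S ω n ∧ ∀ m < n, ¬ occursAt S ω m := by
  have hle : ∀ m, occursAt S ω m → firstOcc S ω ≤ m := fun m hm => iInf₂_le m hm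
  constructor
  · intro h
    have hlt : ∀ m < n, ¬ occursAt S ω m := fun m hm ho => by
      have := hle m ho
      rw [h] at this
      exact absurd (by exact_mod_cast this) (not_le.2 hm)
    refine ⟨?_, hlt⟩
    by_contra hn
    have : ((n + 1 : ℕ) : ℕ∞) ≤ firstOcc S ω := by
      refine le_iInf₂ fun m hm => ?_
      have h1 : ¬ m < n := fun h' => hlt m h' hm
      have h2 : m ≠ n := fun h' => hn (h' ▸ hm)
      exact_mod_cast (by omega : n + 1 ≤ m)
    rw [h] at this
    have : n + 1 ≤ n := by exact_mod_cast this
    omega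
  · rintro ⟨ho, hlt⟩
    refine le_antisymm (hle n ho) (le_iInf₂ fun m hm => ?_)
    have : ¬ m < n := fun h' => hlt m h' hm
    exact_mod_cast (by omega : n ≤ m)

/-- The event that `S` has not occurred by trial `m`. -/
def noOcc (S : List Bool) (m : ℕ) : Set (ℕ → Bool) :=
  {ω | ∀ n ≤ m, ¬ occursAt S ω n}

theorem noOcc_dependsOn (S : List Bool) (m : ℕ) (ω ω' : ℕ → Bool)
    (h : ∀ i < m, ω i = ω' i) (hω : ω ∈ noOcc S m) : ω' ∈ noOcc S m :=
  fun n hn ho => hω n hn ((occursAt_congr hn h).2 ho)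

theorem firstOcc_eq_dependsOn (S : List Bool) (n : ℕ) (ω ω' : ℕ → Bool)
    (h : ∀ i < n, ω i = ω' i) (hω : ω ∈ {ω | firstOcc S ω = (n : ℕ∞)}) :
    ω' ∈ {ω | firstOcc S ω = (n : ℕ∞)} := by
  rw [Set.mem_ofPred_eq, firstOcc_eq_iff] at hω ⊢
  exact ⟨(occursAt_congr le_rfl h).1 hω.1,
    fun m hm ho => hω.2 m hm ((occursAt_congr hm.le h).2 ho)⟩

theorem measurableSet_firstOcc_eq (S : List Bool) (n : ℕ) :
    MeasurableSet {ω | firstOcc S ω = (n : ℕ∞)} :=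
  measurableSet_of_dependsOn (firstOcc_eq_dependsOn S n)

theorem f_ne_top (μ : Measure (ℕ → Bool)) [IsProbabilityMeasure μ] (S : List Bool) (n : ℕ) :
    f μ S n ≠ ∞ :=
  measure_ne_top _ _

theorem f_eq_zero_of_lt_length (μ : Measure (ℕ → Bool)) {S : List Bool} {n : ℕ}
    (hn : n < S.length) : f μ S n = 0 := by
  have : {ω | firstOcc S ω = (n : ℕ∞)} = ∅ := by
    refine Set.eq_empty_iff_forall_notMem.2 fun ω hω => ?_
    have := (firstOcc_eq_iff.1 hω).1.1
    omega
  rw [f, this, measure_empty]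

theorem measure_noOcc_zero (μ : Measure (ℕ → Bool)) [IsProbabilityMeasure μ] {S : List Bool}
    (hS : S ≠ []) : μ (noOcc S 0) = 1 := by
  have : noOcc S 0 = Set.univ := by
    refine Set.eq_univ_of_forall fun ω n hn ho => ?_
    have := ho.1
    have := List.length_pos_of_ne_nil hS
    omega
  rw [this, measure_univ]

theorem measure_noOcc_eq_add (μ : Measure (ℕ → Bool)) (S : List Bool) (m : ℕ) :
    μ (noOcc S m) = μ (noOcc S (m + 1)) + f μ S (m + 1) := by
  have h : noOcc S m = noOcc S (m + 1) ∪ {ω | firstOcc S ω = ((m + 1 : ℕ) : ℕ∞)} := by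
    ext ω
    simp only [noOcc, Set.mem_union, Set.mem_ofPred_eq, firstOcc_eq_iff]
    constructor
    · intro h
      by_cases ho : occursAt S ω (m + 1)
      · exact Or.inr ⟨ho, fun n hn => h n (by omega)⟩
      · refine Or.inl fun n hn => ?_
        rcases Nat.le_succ_iff.1 hn with hn | rfl
        · exact h n hn
        · exact ho
    · rintro (h | h) n hn
      · exact h n (by omega)
      · exact h.2 n (by omega)
  rw [h, measure_union _ (measurableSet_firstOcc_eq S _), f]
  refine Set.disjoint_left.2 fun ω h1 h2 => ?_
  exact h1 _ le_rfl (firstOcc_eq_iff.1 h2).1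

theorem mem_overlaps_self_iff {S : List Bool} {i : ℕ} :
    i ∈ overlaps S S ↔ (1 ≤ i ∧ i ≤ S.length) ∧
      ∀ j < i, S.getD (S.length - i + j) false = S.getD j false := by
  simp only [overlaps, Finset.mem_filter, Finset.mem_Icc, min_self]
  refine and_congr_right fun hi => ?_
  constructor
  · intro h j hj
    have := congrArg (fun l : List Bool => l.getD j false) h
    simpa [List.getD_eq_getElem?_getD, List.getElem?_drop, List.getElem?_take, hj] using this
  · intro h
    refine List.ext_getElem (by simp; omega) fun j h1 h2 => ?_
    have hj : j < i := by simp at h2; omega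
    have := h j hj
    rw [List.getD_eq_getElem _ _ (by omega), List.getD_eq_getElem _ _ (by omega)] at this
    simpa using this

theorem getD_drop (S : List Bool) (i j : ℕ) :
    (S.drop i).getD j false = S.getD (i + j) false := by
  simp [List.getD_eq_getElem?_getD, List.getElem?_drop]

theorem noOcc_inter_readsAt (S : List Bool) (m : ℕ) :
    noOcc S m ∩ readsAt S m = ⋃ i ∈ overlaps S S,
      {ω | firstOcc S ω = ((m + i : ℕ) : ℕ∞)} ∩ readsAt (S.drop i) (m + i) := by
  classical
  ext ω
  simp only [Set.mem_iUnion, exists_prop, Set.mem_inter_iff, Set.mem_ofPred_eq,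
    firstOcc_eq_iff, mem_overlaps_self_iff, readsAt, noOcc, List.length_drop, getD_drop]
  constructor
  · rintro ⟨hno, hr⟩
    have hex : ∃ n, occursAt S ω n :=
      ⟨m + S.length, by omega, fun j hj => by simpa using hr j hj⟩
    have hle : Nat.find hex ≤ m + S.length :=
      Nat.find_min' hex ⟨by omega, fun j hj => by simpa using hr j hj⟩
    have hlt : m < Nat.find hex := by
      by_contra h
      exact hno _ (not_lt.1 h) (Nat.find_spec hex)
    obtain ⟨i, hi⟩ := Nat.exists_eq_add_of_le hlt.le
    have hspec := Nat.find_spec hex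
    rw [hi] at hspec
    refine ⟨i, ⟨⟨by omega, by omega⟩, fun j hj => ?_⟩, ⟨hspec, fun n hn => ?_⟩, fun j hj => ?_⟩
    · have hSi := hspec.1
      rw [← hspec.2 _ (by omega), ← hr j (by omega)]
      congr 1
      omega
    · exact Nat.find_min hex (by omega)
    · rw [← hr _ (by omega)]
      congr 1
      omega
  · rintro ⟨i, ⟨⟨hi1, hik⟩, hov⟩, ⟨hocc, hmin⟩, hr⟩
    refine ⟨fun n hn => hmin n (by omega), fun j hj => ?_⟩
    rcases lt_or_ge j i with hji | hji
    · have := hocc.1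
      rw [← hov j hji, ← hocc.2 _ (by omega)]
      congr 1
      omega
    · obtain ⟨l, rfl⟩ := Nat.exists_eq_add_of_le hji
      rw [← hr l (by omega), add_assoc]

theorem measure_noOcc_mul_strProb {p : ℝ} (hp0 : 0 < p) (hp1 : p < 1)
    (μ : Measure (ℕ → Bool))
    (hμ : ∀ (n : ℕ) (b : ℕ → Bool),
      μ {ω | ∀ i < n, ω i = b i}
        = ∏ i ∈ Finset.range n, (if b i then ENNReal.ofReal p else ENNReal.ofReal (1 - p)))
    (S : List Bool) (m : ℕ) :
    μ (noOcc S m) * ENNReal.ofReal (strProb p S)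
      = ∑ i ∈ overlaps S S, f μ S (m + i) * ENNReal.ofReal (strProb p (S.drop i)) := by
  rw [← measure_inter_readsAt hp0 hp1 μ hμ (noOcc_dependsOn S m) S, noOcc_inter_readsAt,
    measure_biUnion_finset]
  · exact Finset.sum_congr rfl fun i _ =>
      measure_inter_readsAt hp0 hp1 μ hμ (firstOcc_eq_dependsOn S (m + i)) _
  · intro i _ j _ hij
    refine Set.disjoint_left.2 fun ω hi hj => hij ?_
    have : ((m + i : ℕ) : ℕ∞) = ((m + j : ℕ) : ℕ∞) := hi.1.symm.trans hj.1
    have : m + i = m + j := by exact_mod_cast this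
    omega
  · exact fun i _ => (measurableSet_firstOcc_eq S _).inter (measurableSet_readsAt _ _)

theorem strProb_pos {p : ℝ} (hp0 : 0 < p) (hp1 : p < 1) (W : List Bool) : 0 < strProb p W :=
  mul_pos (pow_pos hp0 _) (pow_pos (sub_pos.2 hp1) _)

theorem summable_toReal_mul_pow {a : ℕ → ℝ≥0∞} (ha : ∀ n, a n ≤ 1) {z : ℝ} (hz0 : 0 ≤ z)
    (hz1 : z < 1) : Summable fun n => (a n).toReal * z ^ n := by
  refine Summable.of_nonneg_of_le (fun n => by positivity) (fun n => ?_)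
    (summable_geometric_of_lt_one hz0 hz1)
  have : (a n).toReal ≤ 1 := ENNReal.toReal_le_of_le_ofReal zero_le_one (by simpa using ha n)
  exact mul_le_of_le_one_left (by positivity) this

theorem one_sub_mul_tsum_noOcc (μ : Measure (ℕ → Bool)) [IsProbabilityMeasure μ] {S : List Bool}
    (hS : S ≠ []) {z : ℝ} (hz0 : 0 < z) (hz1 : z < 1) :
    (1 - z) * ∑' m, (μ (noOcc S m)).toReal * z ^ m = 1 - F μ S z := by
  have hu := summable_toReal_mul_pow (a := fun m => μ (noOcc S m)) (fun _ => prob_le_one)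
    hz0.le hz1
  have hf := summable_toReal_mul_pow (a := f μ S) (fun _ => prob_le_one) hz0.le hz1
  have hstep : ∀ m, (μ (noOcc S m)).toReal
      = (μ (noOcc S (m + 1))).toReal + (f μ S (m + 1)).toReal := fun m => by
    rw [measure_noOcc_eq_add, ENNReal.toReal_add (measure_ne_top _ _) (f_ne_top _ _ _)]
  have hF : F μ S z = ∑' m, (f μ S (m + 1)).toReal * z ^ (m + 1) := by
    rw [F, hf.tsum_eq_zero_add, f_eq_zero_of_lt_length μ (List.length_pos_of_ne_nil hS)]
    simp
  have hz : z * ∑' m, (μ (noOcc S m)).toReal * z ^ m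
      = ∑' m, (μ (noOcc S (m + 1))).toReal * z ^ (m + 1)
        + ∑' m, (f μ S (m + 1)).toReal * z ^ (m + 1) := by
    rw [← ((summable_nat_add_iff 1).2 hu).tsum_add ((summable_nat_add_iff 1).2 hf),
      ← tsum_mul_left]
    refine tsum_congr fun m => ?_
    rw [hstep m]
    ring
  have h0 := hu.tsum_eq_zero_add
  rw [measure_noOcc_zero μ hS] at h0
  simp only [ENNReal.toReal_one, pow_zero, mul_one] at h0
  rw [hF]
  linarith

theorem hasSum_f_add (μ : Measure (ℕ → Bool)) [IsProbabilityMeasure μ] {S : List Bool} {i : ℕ}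
    (hi : i ≤ S.length) {z : ℝ} (hz0 : 0 < z) (hz1 : z < 1) :
    HasSum (fun m => (f μ S (m + i)).toReal * z ^ (m + i)) (F μ S z) := by
  have hf := summable_toReal_mul_pow (a := f μ S) (fun _ => prob_le_one) hz0.le hz1
  refine (hasSum_nat_add_iff (f := fun n => (f μ S n).toReal * z ^ n) i).2 ?_
  rw [Finset.sum_eq_zero, add_zero]
  · exact hf.hasSum
  · intro n hn
    rw [f_eq_zero_of_lt_length μ (by have := Finset.mem_range.1 hn; omega)]
    simp

theorem tsum_noOcc_mul_strProb {p : ℝ} (hp0 : 0 < p) (hp1 : p < 1)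
    (μ : Measure (ℕ → Bool)) [IsProbabilityMeasure μ]
    (hμ : ∀ (n : ℕ) (b : ℕ → Bool),
      μ {ω | ∀ i < n, ω i = b i}
        = ∏ i ∈ Finset.range n, (if b i then ENNReal.ofReal p else ENNReal.ofReal (1 - p)))
    (S : List Bool) {z : ℝ} (hz0 : 0 < z) (hz1 : z < 1) :
    (∑' m, (μ (noOcc S m)).toReal * z ^ m) * (strProb p S * z ^ S.length)
      = (∑ ℓ ∈ overlaps S S, strProb p (S.drop ℓ) * z ^ (S.length - ℓ)) * F μ S z := by
  have hsum : HasSum (fun m => ∑ ℓ ∈ overlaps S S, strProb p (S.drop ℓ) * z ^ (S.length - ℓ)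
        * ((f μ S (m + ℓ)).toReal * z ^ (m + ℓ)))
      (∑ ℓ ∈ overlaps S S, strProb p (S.drop ℓ) * z ^ (S.length - ℓ) * F μ S z) :=
    hasSum_sum fun ℓ hℓ =>
      (hasSum_f_add μ (mem_overlaps_self_iff.1 hℓ).1.2 hz0 hz1).mul_left _
  rw [Finset.sum_mul, ← hsum.tsum_eq, ← tsum_mul_right]
  refine tsum_congr fun m => ?_
  have h := congrArg ENNReal.toReal (measure_noOcc_mul_strProb hp0 hp1 μ hμ S m)
  rw [ENNReal.toReal_mul, ENNReal.toReal_ofReal (strProb_pos hp0 hp1 S).le,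
    ENNReal.toReal_sum fun ℓ _ => ENNReal.mul_ne_top (f_ne_top _ _ _)
      ENNReal.ofReal_ne_top] at h
  calc (μ (noOcc S m)).toReal * z ^ m * (strProb p S * z ^ S.length)
      = (μ (noOcc S m)).toReal * strProb p S * z ^ (m + S.length) := by ring
    _ = _ := by
      rw [h, Finset.sum_mul]
      refine Finset.sum_congr rfl fun ℓ hℓ => ?_
      have hℓ' := (mem_overlaps_self_iff.1 hℓ).1.2
      rw [ENNReal.toReal_mul, ENNReal.toReal_ofReal (strProb_pos hp0 hp1 _).le,
        show m + S.length = (S.length - ℓ) + (m + ℓ) by omega, pow_add z (S.length - ℓ)]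
      ring

theorem stmt3 (p : ℝ) (hp0 : 0 < p) (hp1 : p < 1)
    (μ : Measure (ℕ → Bool)) [IsProbabilityMeasure μ]
    (hμ : ∀ (n : ℕ) (b : ℕ → Bool),
      μ {ω | ∀ i < n, ω i = b i}
        = ∏ i ∈ Finset.range n, (if b i then ENNReal.ofReal p else ENNReal.ofReal (1 - p)))
    (S : List Bool) (hS : S ≠ [])
    (z : ℝ) (hz0 : 0 < z) (hz1 : z < 1) :
    F μ S z
      = (1 + (1 - z) *
          ((∑ ℓ ∈ overlaps S S, strProb p (S.drop ℓ) * z ^ (S.length - ℓ)) /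
            (strProb p S * z ^ S.length)))⁻¹ := by
  have hD : 0 < strProb p S * z ^ S.length := mul_pos (strProb_pos hp0 hp1 S) (pow_pos hz0 _)
  have hC : 0 ≤ ∑ ℓ ∈ overlaps S S, strProb p (S.drop ℓ) * z ^ (S.length - ℓ) :=
    Finset.sum_nonneg fun ℓ _ => mul_nonneg (strProb_pos hp0 hp1 _).le (pow_nonneg hz0.le _)
  have h1 := one_sub_mul_tsum_noOcc μ hS hz0 hz1
  have h2 := tsum_noOcc_mul_strProb hp0 hp1 μ hμ S hz0 hz1
  set C := ∑ ℓ ∈ overlaps S S, strProb p (S.drop ℓ) * z ^ (S.length - ℓ)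
  set D := strProb p S * z ^ S.length
  refine eq_inv_of_mul_eq_one_left ?_
  field_simp
  linear_combination (-(1 - z)) * h2 + D * h1
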